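/- arXiv:2604.09410 — 8 statements merged into one kernel-verified Lean document; each statement's English description precedes it below -/
import Mathlib

section
/- Unweighted projection bound (Appendix Lemma 2, second inequality). Let d ≥ 2, let p : Fin d → ℝ be a probability vector with p(j) > 0 for all j (so Σ_j p(j) = 1), and let K := diag(1/p(0), …, 1/p(d−1)). Let r ≥ 1 and let A be any real d×r matrix with linearly independent columns, and set Mat := A·(AᵀKA)⁻¹·Aᵀ. Then Σ_{i,j} Mat_{i,j} ≤ 1. -/
open Matrix

noncomputable section

/-- A symmetric matrix `M` satisfying `M * diag(1/p) * M = M` for a positive probability vector `p`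
has entries summing to at most `1`. -/
theorem sum_entries_le_one_of_mul_diagonal_inv_mul_self {ι : Type*} [Fintype ι] [DecidableEq ι]
    {p : ι → ℝ} (hp : ∀ j, 0 < p j) (hsum : ∑ j, p j = 1) {M : Matrix ι ι ℝ} (hM : M.IsSymm)
    (hMM : M * diagonal (fun j => (p j)⁻¹) * M = M) : ∑ i, ∑ j, M i j ≤ 1 := by
  set v : ι → ℝ := M *ᵥ 1 with hv
  have sum_v : ∑ i, v i = ∑ i, ∑ j, M i j := by simp [hv, mulVec, dotProduct]
  have vecMul_one : 1 ᵥ* M = v := by rw [hv, ← vecMul_transpose, hM.eq]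
  have quad : ∑ i, v i * (p i)⁻¹ * v i = ∑ i, v i := by
    have h : 1 ⬝ᵥ ((M * diagonal (fun j => (p j)⁻¹) * M) *ᵥ 1) = 1 ⬝ᵥ v := by rw [hMM]
    rw [← mulVec_mulVec, ← hv, dotProduct_mulVec, ← vecMul_vecMul, vecMul_one] at h
    simpa [dotProduct, vecMul_diagonal] using h
  have nonneg : 0 ≤ ∑ i, (v i - p i) ^ 2 * (p i)⁻¹ :=
    Finset.sum_nonneg fun i _ => mul_nonneg (sq_nonneg _) (inv_nonneg.2 (hp i).le)
  have expand : ∑ i, (v i - p i) ^ 2 * (p i)⁻¹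
      = ∑ i, v i * (p i)⁻¹ * v i - 2 * ∑ i, v i + ∑ i, p i := by
    rw [Finset.mul_sum, ← Finset.sum_sub_distrib, ← Finset.sum_add_distrib]
    refine Finset.sum_congr rfl fun i _ => ?_
    have := (hp i).ne'
    field_simp
    ring
  linarith

/-- The junk value `0` of the inverse of a singular matrix makes this hold for every `G`. -/
theorem nonsing_inv_mul_self_mul_nonsing_inv {ι R : Type*} [Fintype ι] [DecidableEq ι]
    [CommRing R] (G : Matrix ι ι R) : G⁻¹ * G * G⁻¹ = G⁻¹ := by
  by_cases h : IsUnit G.det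
  · rw [nonsing_inv_mul G h, Matrix.one_mul]
  · simp [nonsing_inv_apply_not_isUnit G h]

/-- **Unweighted projection bound**: for `K = diag(1/p)` with `p` a positive probability
vector and `A` with linearly independent columns, the entries of `A (AᵀKA)⁻¹ Aᵀ` sum
to at most `1`. -/
theorem unweighted_projection_bound
    (d r : ℕ) (hd : 2 ≤ d) (hr : 1 ≤ r)
    (p : Fin d → ℝ) (hp : ∀ j, 0 < p j) (hsum : ∑ j, p j = 1)
    (A : Matrix (Fin d) (Fin r) ℝ)
    (hA : LinearIndependent ℝ (fun j => Aᵀ j)) :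
    ∑ i, ∑ j,
        (A * (Aᵀ * Matrix.diagonal (fun j => (p j)⁻¹) * A)⁻¹ * Aᵀ) i j ≤ 1 := by
  set K := diagonal fun j => (p j)⁻¹ with hK
  refine sum_entries_le_one_of_mul_diagonal_inv_mul_self hp hsum ?_ ?_
  · simp [IsSymm, transpose_mul, transpose_nonsing_inv, Matrix.mul_assoc, hK]
  · calc A * (Aᵀ * K * A)⁻¹ * Aᵀ * K * (A * (Aᵀ * K * A)⁻¹ * Aᵀ)
        = A * ((Aᵀ * K * A)⁻¹ * (Aᵀ * K * A) * (Aᵀ * K * A)⁻¹) * Aᵀ := by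
          simp only [Matrix.mul_assoc]
      _ = A * (Aᵀ * K * A)⁻¹ * Aᵀ := by rw [nonsing_inv_mul_self_mul_nonsing_inv]

end
end

section
/- Constrained-projection identity. Let K be a d×d real positive definite matrix, let C be an m×d real matrix of rank m with m < d, and let A be a d×(d−m) real matrix with linearly independent columns whose column space equals ker C. Then A·(AᵀKA)⁻¹·Aᵀ = K⁻¹ − K⁻¹Cᵀ(CK⁻¹Cᵀ)⁻¹CK⁻¹. -/
open Matrix

noncomputable section

/-- If the columns of `P` are killed by `C` and the columns of `A` span `ker C`, then `P` factors
through `A`. -/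
theorem exists_eq_mul_of_span_range_eq_ker {R l m n o : Type*} [CommRing R] [Fintype n] [Fintype o]
    {C : Matrix m n R} {A : Matrix n o R} {P : Matrix n l R}
    (hcol : Submodule.span R (Set.range fun j => Aᵀ j) = LinearMap.ker C.mulVecLin)
    (hP : C * P = 0) : ∃ X : Matrix o l R, P = A * X := by
  have h (j : l) : ∃ x, A *ᵥ x = Pᵀ j := by
    have hj : Pᵀ j ∈ LinearMap.ker C.mulVecLin :=
      LinearMap.mem_ker.2 (funext fun i => congrFun (congrFun hP i) j)
    rw [← hcol] at hj
    exact (range_mulVecLin A).ge hj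
  choose x hx using h
  exact ⟨(of x)ᵀ, ext fun i j => (congrFun (hx j) i).symm⟩

/-- **Constrained-projection identity**:
`A (AᵀKA)⁻¹ Aᵀ = K⁻¹ − K⁻¹Cᵀ (C K⁻¹ Cᵀ)⁻¹ C K⁻¹` whenever the columns of `A` are a basis
of `ker C`. -/
theorem constrained_projection_identity
    (d m : ℕ) (hm : m < d)
    (K : Matrix (Fin d) (Fin d) ℝ) (hK : K.PosDef)
    (C : Matrix (Fin m) (Fin d) ℝ) (hC : C.rank = m)
    (A : Matrix (Fin d) (Fin (d - m)) ℝ)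
    (hA : LinearIndependent ℝ (fun j => Aᵀ j))
    (hcol : Submodule.span ℝ (Set.range fun j => Aᵀ j) = LinearMap.ker C.mulVecLin) :
    A * (Aᵀ * K * A)⁻¹ * Aᵀ =
      K⁻¹ - K⁻¹ * Cᵀ * (C * K⁻¹ * Cᵀ)⁻¹ * C * K⁻¹ := by
  have hCA : C * A = 0 := by
    ext i j
    have hj : Aᵀ j ∈ LinearMap.ker C.mulVecLin := hcol ▸ Submodule.subset_span ⟨j, rfl⟩
    exact congrFun (LinearMap.mem_ker.1 hj) i
  have hACt : Aᵀ * Cᵀ = 0 := by rw [← transpose_mul, hCA, transpose_zero]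
  have hCrow : LinearIndependent ℝ C.row := by
    rw [linearIndependent_iff_card_eq_finrank_span, Fintype.card_fin, Set.finrank,
      ← rank_eq_finrank_span_row, hC]
  have hS : IsUnit (C * K⁻¹ * Cᵀ).det :=
    (isUnit_iff_isUnit_det _).1 <| by
      simpa using (hK.inv.mul_mul_conjTranspose_same (vecMul_injective_iff.2 hCrow)).isUnit
  have hM : IsUnit (Aᵀ * K * A).det :=
    (isUnit_iff_isUnit_det _).1 <| by
      simpa using (hK.conjTranspose_mul_mul_same (mulVec_injective_iff.2 hA)).isUnit
  have hKu : IsUnit K.det := (isUnit_iff_isUnit_det _).1 hK.isUnit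
  set S := C * K⁻¹ * Cᵀ with hSdef
  have hCP : C * (K⁻¹ - K⁻¹ * Cᵀ * S⁻¹ * C * K⁻¹) = 0 := by
    have : C * (K⁻¹ * Cᵀ * S⁻¹ * C * K⁻¹) = S * S⁻¹ * C * K⁻¹ := by
      simp only [hSdef, Matrix.mul_assoc]
    rw [Matrix.mul_sub, this, mul_nonsing_inv _ hS, Matrix.one_mul, sub_self]
  have hAP : Aᵀ * K * (K⁻¹ - K⁻¹ * Cᵀ * S⁻¹ * C * K⁻¹) = Aᵀ := by
    have : Aᵀ * K * (K⁻¹ * Cᵀ * S⁻¹ * C * K⁻¹) = Aᵀ * (K * K⁻¹) * Cᵀ * S⁻¹ * C * K⁻¹ := by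
      simp only [Matrix.mul_assoc]
    rw [Matrix.mul_sub, this, Matrix.mul_assoc, mul_nonsing_inv _ hKu, Matrix.mul_one, hACt]
    simp only [Matrix.zero_mul, sub_zero]
  obtain ⟨X, hX⟩ := exists_eq_mul_of_span_range_eq_ker hcol hCP
  rw [hX, ← Matrix.mul_assoc] at hAP
  rw [hX, Matrix.mul_assoc]
  have hX' : (Aᵀ * K * A)⁻¹ * Aᵀ = X :=
    (congrArg ((Aᵀ * K * A)⁻¹ * ·) hAP).symm.trans (nonsing_inv_mul_cancel_left _ X hM)
  rw [hX']

end
end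

section
/- Relative-entropy bound for marginals of energy-shell states (Appendix Lemma on sampling without vs. with replacement). Fix d ≥ 2, a map E : Fin d → ℝ, integers N ≥ 2 and 1 ≤ k ≤ N, and an achievable total energy Е. Let p be the probability distribution on (Fin d)^k defined by p(y) := #{x : Fin N → Fin d : Σ_j E(x j) = Е and x_i = y_i for all i < k} / g(Е) (the law of the first k letters of a uniformly random length-N string of total energy Е; these are exactly the diagonal entries of the partial trace of the normalized shell projector P_Е/g(Е), which is a diagonal matrix), and let q(y) := Σ_{P∈S(Е)} μ_Е(P)·∏_{i<k} P(y_i). Then D(p‖q) ≤ (d−1)·k·(k−1) / (2·(N−1)·(N−k+1)). -/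
open scoped Classical

noncomputable section

/-- The number of occurrences of the letter `j` in the string `y`. -/
def letterCount {d k : ℕ} (y : Fin k → Fin d) (j : Fin d) : ℕ :=
  (Finset.univ.filter fun i => y i = j).card

/-- `|T_P|`: the number of length-`N` strings whose letter counts are `n` (type `P = n/N`). -/
def typeClassCard (d N : ℕ) (n : Fin d → ℕ) : ℕ :=
  (Finset.univ.filter fun x : Fin N → Fin d => ∀ j, letterCount x j = n j).card

/-- `S(Е)`: the types of length-`N` strings of total energy `En`, represented by their
count vectors `n` (the type is `P = n/N`). -/
def typesOfEnergy (d N : ℕ) (E : Fin d → ℝ) (En : ℝ) : Finset (Fin d → ℕ) :=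
  ((Finset.univ : Finset (Fin d → Fin (N + 1))).image fun n j => (n j : ℕ)).filter
    fun n => (∑ j, n j = N) ∧ (∑ j, (n j : ℝ) * E j) = En

/-- `g(Е) = Σ_{P ∈ S(Е)} |T_P|`: the number of length-`N` strings of total energy `En`. -/
def gE (d N : ℕ) (E : Fin d → ℝ) (En : ℝ) : ℕ :=
  ∑ n ∈ typesOfEnergy d N E En, typeClassCard d N n

/-- `μ_Е(P) = |T_P| / g(Е)`. -/
def muE (d N : ℕ) (E : Fin d → ℝ) (En : ℝ) (n : Fin d → ℕ) : ℝ :=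
  (typeClassCard d N n : ℝ) / (gE d N E En : ℝ)

/-- The number of length-`N` strings of total energy `En` whose first `k` letters are `y`. -/
def prefixCount (d N k : ℕ) (hk : k ≤ N) (E : Fin d → ℝ) (En : ℝ) (y : Fin k → Fin d) : ℕ :=
  (Finset.univ.filter fun x : Fin N → Fin d =>
    (∑ j, E (x j)) = En ∧ ∀ i : Fin k, x (Fin.castLE hk i) = y i).card

section

open Finset

/-- The probability of drawing the string `y` without replacement from an urn with `N` balls,
`n j` of which carry the letter `j`. -/
def drawProb {d : ℕ} (N : ℕ) (n : Fin d → ℕ) : (k : ℕ) → (Fin k → Fin d) → ℝ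
  | 0, _ => 1
  | k + 1, y => drawProb N n k (Fin.init y) *
      (((n (y (Fin.last k)) : ℝ) - letterCount (Fin.init y) (y (Fin.last k))) / (N - k))

/-- The strings with letter counts `n` whose first `k` letters are `y`. -/
def typePrefix {d N k : ℕ} (hk : k ≤ N) (n : Fin d → ℕ) (y : Fin k → Fin d) :
    Finset (Fin N → Fin d) :=
  univ.filter fun x => (∀ j, letterCount x j = n j) ∧ ∀ i : Fin k, x (Fin.castLE hk i) = y i

theorem sum_fin_succ_arrow {d k : ℕ} (f : (Fin (k + 1) → Fin d) → ℝ) :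
    ∑ y, f y = ∑ y : Fin k → Fin d, ∑ a, f (Fin.snoc y a) := by
  rw [← (Fin.snocEquiv fun _ => Fin d).sum_comp, Fintype.sum_prod_type, sum_comm]
  rfl

theorem drawProb_snoc {d k : ℕ} (N : ℕ) (n : Fin d → ℕ) (y : Fin k → Fin d) (a : Fin d) :
    drawProb N n (k + 1) (Fin.snoc y a) =
      drawProb N n k y * (((n a : ℝ) - letterCount y a) / (N - k)) := by
  simp [drawProb]

theorem letterCount_eq_sum {d k : ℕ} (y : Fin k → Fin d) (j : Fin d) :
    letterCount y j = ∑ i, if y i = j then 1 else 0 := by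
  simp [letterCount]

theorem letterCount_snoc {d k : ℕ} (y : Fin k → Fin d) (a j : Fin d) :
    letterCount (Fin.snoc y a : Fin (k + 1) → Fin d) j =
      letterCount y j + if a = j then 1 else 0 := by
  rw [letterCount_eq_sum, letterCount_eq_sum, Fin.sum_univ_castSucc]
  simp only [Fin.snoc_castSucc, Fin.snoc_last]

theorem sum_letterCount {d k : ℕ} (y : Fin k → Fin d) : ∑ j, letterCount y j = k := by
  simp only [letterCount_eq_sum]
  rw [sum_comm]
  simp

theorem letterCount_comp_perm {d N : ℕ} (x : Fin N → Fin d) (σ : Equiv.Perm (Fin N))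
    (j : Fin d) : letterCount (x ∘ σ) j = letterCount x j := by
  simp only [letterCount_eq_sum, Function.comp]
  exact Equiv.sum_comp σ fun i => if x i = j then 1 else 0

theorem letterCount_eq_prefix_add_suffix {d N k : ℕ} (hk : k ≤ N) (x : Fin N → Fin d)
    (y : Fin k → Fin d) (hy : ∀ i, x (Fin.castLE hk i) = y i) (a : Fin d) :
    letterCount x a =
      letterCount y a + ∑ l : Fin N with k ≤ l.val, if x l = a then 1 else 0 := by
  rw [letterCount_eq_sum x, ← sum_filter_add_sum_filter_not univ fun l : Fin N => l.val < k]
  simp only [not_lt]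
  congr 1
  rw [letterCount_eq_sum]
  symm
  refine sum_bij (fun i _ => Fin.castLE hk i) ?_ ?_ ?_ ?_
  · simp
  · intro i _ j _ h
    simpa using h
  · intro l hl
    exact ⟨⟨l, by simpa using hl⟩, mem_univ _, rfl⟩
  · intro i _
    rw [hy]

theorem card_typePrefix_filter {d N k : ℕ} (hk : k + 1 ≤ N) (n : Fin d → ℕ)
    (y : Fin (k + 1) → Fin d) (l : Fin N) (hl : k ≤ l.val) :
    ((typePrefix (Nat.le_of_succ_le hk) n (Fin.init y)).filter
      fun x => x l = y (Fin.last k)).card = (typePrefix hk n y).card := by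
  set m : Fin N := ⟨k, hk⟩ with hm
  have hfix : ∀ i : Fin k, Equiv.swap l m (Fin.castLE (Nat.le_of_succ_le hk) i) =
      Fin.castLE (Nat.le_of_succ_le hk) i := by
    intro i
    have := i.isLt
    apply Equiv.swap_apply_of_ne_of_ne
    · intro h
      have := congrArg Fin.val h
      simp at this
      omega
    · intro h
      have := congrArg Fin.val h
      simp [hm] at this
      omega
  have hlast : Fin.castLE hk (Fin.last k) = m := rfl
  refine card_bij' (fun x _ => x ∘ Equiv.swap l m) (fun x _ => x ∘ Equiv.swap l m) ?_ ?_ ?_ ?_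
  · intro x hx
    simp only [typePrefix, mem_filter, mem_univ, true_and] at hx ⊢
    refine ⟨fun j => by rw [letterCount_comp_perm, hx.1.1], fun i => ?_⟩
    induction i using Fin.lastCases with
    | last => simp [hlast, hx.2]
    | cast i =>
      have := hx.1.2 i
      simp only [Function.comp]
      exact (congrArg x (hfix i)).trans this
  · intro x hx
    simp only [typePrefix, mem_filter, mem_univ, true_and] at hx ⊢
    refine ⟨⟨fun j => by rw [letterCount_comp_perm, hx.1], fun i => ?_⟩, ?_⟩
    · simp only [Function.comp, hfix]
      exact hx.2 i.castSucc
    · simpa [hlast] using hx.2 (Fin.last k)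
  · intro x _
    ext
    simp
  · intro x _
    ext
    simp

theorem card_typePrefix_succ {d N k : ℕ} (hk : k + 1 ≤ N) (n : Fin d → ℕ)
    (y : Fin (k + 1) → Fin d) :
    ((typePrefix hk n y).card : ℝ) * (N - k) =
      (typePrefix (Nat.le_of_succ_le hk) n (Fin.init y)).card *
        ((n (y (Fin.last k)) : ℝ) - letterCount (Fin.init y) (y (Fin.last k))) := by
  set a := y (Fin.last k) with ha
  set A := typePrefix (Nat.le_of_succ_le hk) n (Fin.init y) with hA
  have hsuffix : ∀ x ∈ A, ((∑ l : Fin N with k ≤ l.val, if x l = a then 1 else 0 : ℕ) : ℝ) =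
      (n a : ℝ) - letterCount (Fin.init y) a := by
    intro x hx
    simp only [hA, typePrefix, mem_filter, mem_univ, true_and] at hx
    rw [← hx.1 a, letterCount_eq_prefix_add_suffix _ x (Fin.init y) hx.2 a]
    push_cast
    ring
  have hcard : (univ.filter fun l : Fin N => k ≤ l.val).card = N - k := by
    have := Fin.card_Ici (⟨k, hk⟩ : Fin N)
    rw [← this]
    congr 1
    ext l
    simp [Fin.le_def]
  have hswap : ∑ x ∈ A, ∑ l : Fin N with k ≤ l.val, (if x l = a then 1 else 0 : ℕ) =
      (N - k) * (typePrefix hk n y).card := by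
    rw [sum_comm, ← hcard, ← smul_eq_mul, ← sum_const]
    refine sum_congr rfl fun l hl => ?_
    rw [← card_typePrefix_filter hk n y l (by simpa using hl), card_filter]
  calc ((typePrefix hk n y).card : ℝ) * (N - k)
      = (((N - k) * (typePrefix hk n y).card : ℕ) : ℝ) := by
        push_cast [Nat.cast_sub (Nat.le_of_succ_le hk)]
        ring
    _ = ∑ x ∈ A, ((∑ l : Fin N with k ≤ l.val, if x l = a then 1 else 0 : ℕ) : ℝ) := by
        rw [← hswap]
        push_cast
        rfl
    _ = _ := by rw [sum_congr rfl hsuffix, sum_const, nsmul_eq_mul]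

theorem card_typePrefix_eq {d N k : ℕ} (hk : k ≤ N) (n : Fin d → ℕ) (y : Fin k → Fin d) :
    ((typePrefix hk n y).card : ℝ) = typeClassCard d N n * drawProb N n k y := by
  induction k with
  | zero => simp [typePrefix, typeClassCard, drawProb]
  | succ k ih =>
    have hpos : (0 : ℝ) < N - k := by
      have : (k : ℝ) + 1 ≤ N := by exact_mod_cast hk
      linarith
    have h := card_typePrefix_succ hk n y
    rw [ih] at h
    rw [drawProb, ← mul_left_inj' hpos.ne', h]
    field_simp

theorem drawProb_nonneg {d N k : ℕ} (hk : k ≤ N) (n : Fin d → ℕ)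
    (hT : 0 < typeClassCard d N n) (y : Fin k → Fin d) : 0 ≤ drawProb N n k y := by
  have hT' : (0 : ℝ) < typeClassCard d N n := by exact_mod_cast hT
  refine nonneg_of_mul_nonneg_right (a := (typeClassCard d N n : ℝ)) ?_ hT'
  rw [← card_typePrefix_eq hk]
  positivity

theorem pos_of_mem_typePrefix {d N k : ℕ} {hk : k ≤ N} {n : Fin d → ℕ} {y : Fin k → Fin d}
    {x : Fin N → Fin d} (hx : x ∈ typePrefix hk n y) (i : Fin k) : 0 < n (y i) := by
  simp only [typePrefix, mem_filter, mem_univ, true_and] at hx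
  rw [← hx.1, letterCount, card_pos]
  exact ⟨Fin.castLE hk i, by simpa using hx.2 i⟩

theorem pos_of_drawProb_ne_zero {d N k : ℕ} (hk : k ≤ N) (n : Fin d → ℕ)
    (hT : 0 < typeClassCard d N n) {y : Fin k → Fin d} (hy : drawProb N n k y ≠ 0) (i : Fin k) :
    0 < n (y i) := by
  have hne : (typePrefix hk n y).card ≠ 0 := by
    rw [← Nat.cast_ne_zero (R := ℝ), card_typePrefix_eq]
    exact mul_ne_zero (by exact_mod_cast hT.ne') hy
  obtain ⟨x, hx⟩ := card_ne_zero.1 hne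
  exact pos_of_mem_typePrefix hx i

theorem sum_draw_step {d N k : ℕ} (hk : k < N) (n : Fin d → ℕ) (hn : ∑ j, n j = N)
    (y : Fin k → Fin d) : ∑ a, ((n a : ℝ) - letterCount y a) / (N - k) = 1 := by
  have hpos : (0 : ℝ) < N - k := sub_pos.2 (by exact_mod_cast hk)
  rw [← sum_div, sum_sub_distrib, ← Nat.cast_sum, ← Nat.cast_sum, hn, sum_letterCount,
    div_self hpos.ne']

theorem sum_drawProb {d N k : ℕ} (hk : k ≤ N) (n : Fin d → ℕ) (hn : ∑ j, n j = N) :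
    ∑ y, drawProb N n k y = 1 := by
  induction k with
  | zero => simp [drawProb]
  | succ k ih =>
    rw [sum_fin_succ_arrow, ← ih (by omega)]
    refine sum_congr rfl fun y _ => ?_
    simp_rw [drawProb_snoc]
    rw [← mul_sum, sum_draw_step hk n hn, mul_one]

theorem sum_drawProb_succ_mul {d N k : ℕ} (hk : k < N) (n : Fin d → ℕ) (hn : ∑ j, n j = N)
    (j : Fin d) (f : ℕ → ℝ) :
    ∑ y, drawProb N n (k + 1) y * f (letterCount y j) =
      ∑ y, drawProb N n k y * (f (letterCount y j) +
        ((n j : ℝ) - letterCount y j) / (N - k) *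
          (f (letterCount y j + 1) - f (letterCount y j))) := by
  rw [sum_fin_succ_arrow]
  refine sum_congr rfl fun y _ => ?_
  have hterm : ∀ a, drawProb N n (k + 1) (Fin.snoc y a) *
        f (letterCount (Fin.snoc y a : Fin (k + 1) → Fin d) j) =
      drawProb N n k y * (((n a : ℝ) - letterCount y a) / (N - k) * f (letterCount y j) +
        if a = j then ((n a : ℝ) - letterCount y a) / (N - k) *
          (f (letterCount y j + 1) - f (letterCount y j)) else 0) := by
    intro a
    rw [drawProb_snoc, letterCount_snoc]
    split_ifs
    · ring
    · rw [add_zero, add_zero]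
      ring
  rw [sum_congr rfl fun a _ => hterm a, ← mul_sum, sum_add_distrib, ← sum_mul,
    sum_draw_step hk n hn, one_mul, sum_ite_eq' univ j]
  simp

theorem sum_drawProb_mul_letterCount {d N k : ℕ} (hk : k ≤ N) (n : Fin d → ℕ)
    (hn : ∑ j, n j = N) (j : Fin d) :
    ∑ y, drawProb N n k y * letterCount y j = k * n j / N := by
  induction k with
  | zero => simp [letterCount]
  | succ k ih =>
    have hpos : (0 : ℝ) < N - k := sub_pos.2 (by exact_mod_cast hk)
    have hN : (0 : ℝ) < N := by exact_mod_cast (by omega : 0 < N)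
    have hsplit : ∀ y : Fin k → Fin d, drawProb N n k y * ((letterCount y j : ℝ) +
        ((n j : ℝ) - letterCount y j) / (N - k) *
          (((letterCount y j + 1 : ℕ) : ℝ) - letterCount y j)) =
        (n j / (N - k)) * drawProb N n k y +
          (1 - 1 / (N - k)) * (drawProb N n k y * letterCount y j) := by
      intro y
      push_cast
      field_simp
      ring
    rw [sum_drawProb_succ_mul hk n hn j fun m => (m : ℝ), sum_congr rfl fun y _ => hsplit y,
      sum_add_distrib, ← mul_sum, ← mul_sum, sum_drawProb (Nat.le_of_succ_le hk) n hn,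
      ih (by omega)]
    push_cast
    field_simp
    ring

theorem sum_drawProb_mul_letterCount_sq {d N k : ℕ} (hN : 2 ≤ N) (hk : k ≤ N) (n : Fin d → ℕ)
    (hn : ∑ j, n j = N) (j : Fin d) :
    ∑ y, drawProb N n k y * (letterCount y j : ℝ) ^ 2 =
      k * (k - 1) * n j * (n j - 1) / (N * (N - 1)) + k * n j / N := by
  have hN0 : (0 : ℝ) < N := by exact_mod_cast (by omega : 0 < N)
  have hN1 : (0 : ℝ) < N - 1 := sub_pos.2 (by exact_mod_cast (by omega : 1 < N))
  induction k with
  | zero => simp [letterCount]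
  | succ k ih =>
    have hpos : (0 : ℝ) < N - k := sub_pos.2 (by exact_mod_cast hk)
    have hsplit : ∀ y : Fin k → Fin d, drawProb N n k y * ((letterCount y j : ℝ) ^ 2 +
        ((n j : ℝ) - letterCount y j) / (N - k) *
          (((letterCount y j + 1 : ℕ) : ℝ) ^ 2 - (letterCount y j : ℝ) ^ 2)) =
        (n j / (N - k)) * drawProb N n k y +
          ((2 * n j - 1) / (N - k)) * (drawProb N n k y * letterCount y j) +
          (1 - 2 / (N - k)) * (drawProb N n k y * (letterCount y j : ℝ) ^ 2) := by
      intro y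
      push_cast
      field_simp
      ring
    rw [sum_drawProb_succ_mul hk n hn j fun m => (m : ℝ) ^ 2,
      sum_congr rfl fun y _ => hsplit y, sum_add_distrib, sum_add_distrib, ← mul_sum, ← mul_sum,
      ← mul_sum, sum_drawProb (Nat.le_of_succ_le hk) n hn,
      sum_drawProb_mul_letterCount (Nat.le_of_succ_le hk) n hn,
      ih (by omega)]
    push_cast
    field_simp
    ring

theorem sum_drawProb_mul_chiSq_le {d N k : ℕ} (hN : 2 ≤ N) (hk : k < N) (n : Fin d → ℕ)
    (hn : ∑ j, n j = N) (j : Fin d) :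
    ∑ y, drawProb N n k y * (((n j : ℝ) - letterCount y j) / (N - k) *
      (((n j : ℝ) - letterCount y j) / (N - k) / (n j / N) - 1)) ≤
      k * (1 - n j / N) / ((N - k) * (N - 1)) := by
  have hN0 : (0 : ℝ) < N := by exact_mod_cast (by omega : 0 < N)
  have hN1 : (0 : ℝ) < N - 1 := sub_pos.2 (by exact_mod_cast (by omega : 1 < N))
  have hpos : (0 : ℝ) < N - k := sub_pos.2 (by exact_mod_cast hk)
  rcases (n j).eq_zero_or_pos with h0 | h0
  · have hmean := sum_drawProb_mul_letterCount hk.le n hn j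
    have hterm : ∀ y : Fin k → Fin d, drawProb N n k y * (((n j : ℝ) - letterCount y j) / (N - k) *
        (((n j : ℝ) - letterCount y j) / (N - k) / (n j / N) - 1)) =
        1 / (N - k) * (drawProb N n k y * letterCount y j) := by
      intro y
      simp [h0]
      ring
    rw [sum_congr rfl fun y _ => hterm y, ← mul_sum, hmean]
    simp only [h0, Nat.cast_zero, mul_zero, zero_div, sub_zero, mul_one]
    positivity
  · have hn0 : (0 : ℝ) < n j := by exact_mod_cast h0
    have hterm : ∀ y : Fin k → Fin d, drawProb N n k y * (((n j : ℝ) - letterCount y j) / (N - k) *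
        (((n j : ℝ) - letterCount y j) / (N - k) / (n j / N) - 1)) =
        (n j * N / (N - k) ^ 2 - n j / (N - k)) * drawProb N n k y +
        (1 / (N - k) - 2 * N / (N - k) ^ 2) * (drawProb N n k y * letterCount y j) +
        (N / (n j * (N - k) ^ 2)) * (drawProb N n k y * (letterCount y j : ℝ) ^ 2) := by
      intro y
      field_simp
      ring
    rw [sum_congr rfl fun y _ => hterm y, sum_add_distrib, sum_add_distrib, ← mul_sum,
      ← mul_sum, ← mul_sum, sum_drawProb hk.le n hn, sum_drawProb_mul_letterCount hk.le n hn,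
      sum_drawProb_mul_letterCount_sq hN hk.le n hn]
    apply le_of_eq
    field_simp
    ring

/-- Sampling without versus with replacement from an urn of composition `n`. -/
theorem relEntropy_drawProb_le {d N k : ℕ} (hN : 2 ≤ N) (hk : k ≤ N) (n : Fin d → ℕ)
    (hn : ∑ j, n j = N) (hT : 0 < typeClassCard d N n) :
    ∑ y, drawProb N n k y * Real.log (drawProb N n k y / ∏ i, (n (y i) : ℝ) / N) ≤
      ∑ i ∈ range k, (i : ℝ) * (d - 1) / ((N - i) * (N - 1)) := by
  have hN0 : (0 : ℝ) < N := by exact_mod_cast (by omega : 0 < N)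
  induction k with
  | zero => simp [drawProb]
  | succ k ih =>
    have hstep : ∀ (y : Fin k → Fin d) (a : Fin d),
        drawProb N n (k + 1) (Fin.snoc y a) * Real.log (drawProb N n (k + 1) (Fin.snoc y a) /
          ∏ i, (n ((Fin.snoc y a : Fin (k + 1) → Fin d) i) : ℝ) / N) ≤
        drawProb N n k y * Real.log (drawProb N n k y / ∏ i, (n (y i) : ℝ) / N) *
            (((n a : ℝ) - letterCount y a) / (N - k)) +
          drawProb N n k y * (((n a : ℝ) - letterCount y a) / (N - k) *
            (((n a : ℝ) - letterCount y a) / (N - k) / (n a / N) - 1)) := by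
      intro y a
      have hp := drawProb_nonneg (k := k) (by omega) n hT y
      have hps := drawProb_nonneg hk n hT (Fin.snoc y a)
      have hpos_n : drawProb N n (k + 1) (Fin.snoc y a) ≠ 0 → 0 < n a := fun h => by
        simpa using pos_of_drawProb_ne_zero hk n hT h (Fin.last k)
      rw [Fin.prod_univ_castSucc]
      simp only [Fin.snoc_castSucc, Fin.snoc_last]
      rw [drawProb_snoc] at *
      set p := drawProb N n k y
      set r := ((n a : ℝ) - letterCount y a) / (N - k)
      rcases hp.eq_or_lt with h0 | hp0
      · simp [← h0]
      rcases (nonneg_of_mul_nonneg_right hps hp0).eq_or_lt with h0 | hr0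
      · simp [← h0]
      have hq : 0 < (n a : ℝ) / N :=
        div_pos (by exact_mod_cast hpos_n (mul_pos hp0 hr0).ne') hN0
      have hQ : 0 < ∏ i, (n (y i) : ℝ) / N := prod_pos fun i _ =>
        div_pos (by exact_mod_cast pos_of_drawProb_ne_zero (by omega) n hT hp0.ne' i) hN0
      rw [mul_div_mul_comm, Real.log_mul (div_pos hp0 hQ).ne' (div_pos hr0 hq).ne']
      have hlog := mul_le_mul_of_nonneg_left (Real.log_le_sub_one_of_pos (div_pos hr0 hq))
        (mul_pos hp0 hr0).le
      linarith
    rw [sum_fin_succ_arrow, sum_range_succ]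
    refine (sum_le_sum fun y _ => sum_le_sum fun a _ => hstep y a).trans ?_
    simp only [sum_add_distrib, ← mul_sum, sum_draw_step hk n hn, mul_one]
    refine add_le_add (ih (by omega)) ?_
    simp only [mul_sum]
    rw [sum_comm]
    refine (sum_le_sum fun j _ => sum_drawProb_mul_chiSq_le hN hk n hn j).trans (le_of_eq ?_)
    rw [← sum_div, ← mul_sum, sum_sub_distrib, ← sum_div, ← Nat.cast_sum, hn, div_self hN0.ne']
    simp

theorem sum_range_mul_div_le {d N k : ℕ} (hd : 1 ≤ d) (hN : 2 ≤ N) (hk : k ≤ N) :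
    ∑ i ∈ range k, (i : ℝ) * (d - 1) / ((N - i) * (N - 1)) ≤
      ((d : ℝ) - 1) * k * ((k : ℝ) - 1) / (2 * ((N : ℝ) - 1) * ((N : ℝ) - k + 1)) := by
  have hN1 : (0 : ℝ) < N - 1 := sub_pos.2 (by exact_mod_cast (by omega : 1 < N))
  have hd1 : (0 : ℝ) ≤ d - 1 := sub_nonneg.2 (by exact_mod_cast hd)
  have hkN : (0 : ℝ) ≤ N - k := sub_nonneg.2 (by exact_mod_cast hk)
  have hterm : ∀ i ∈ range k, (i : ℝ) * (d - 1) / ((N - i) * (N - 1)) ≤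
      i * ((d - 1) / ((N - k + 1) * (N - 1))) := by
    intro i hi
    have hik : (i : ℝ) + 1 ≤ k := by exact_mod_cast mem_range.1 hi
    rw [mul_div_assoc]
    gcongr
    linarith
  have hgauss : ∑ i ∈ range k, (i : ℝ) = k * (k - 1) / 2 := by
    clear hterm hkN hk
    induction k with
    | zero => simp
    | succ k ih =>
      rw [sum_range_succ, ih]
      push_cast
      ring
  refine (sum_le_sum hterm).trans (le_of_eq ?_)
  rw [← sum_mul, hgauss]
  field_simp

/-- The log-sum inequality. -/
theorem sum_mul_log_div_sum_le {ι : Type*} (s : Finset ι) (a b : ι → ℝ)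
    (ha : ∀ i ∈ s, 0 ≤ a i) (hb : ∀ i ∈ s, 0 ≤ b i) (hab : ∀ i ∈ s, b i = 0 → a i = 0) :
    (∑ i ∈ s, a i) * Real.log ((∑ i ∈ s, a i) / ∑ i ∈ s, b i) ≤
      ∑ i ∈ s, a i * Real.log (a i / b i) := by
  set A := ∑ i ∈ s, a i with hA
  set B := ∑ i ∈ s, b i with hB
  rcases (sum_nonneg ha).eq_or_lt with h0 | hA0
  · rw [← hA] at h0
    have hz := (sum_eq_zero_iff_of_nonneg ha).1 h0.symm
    rw [← h0, sum_eq_zero fun i hi => by rw [hz i hi, zero_mul], zero_mul]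
  have hB0 : 0 < B := by
    refine (sum_nonneg hb).lt_of_ne fun h => hA0.ne' ?_
    exact sum_eq_zero fun i hi => hab i hi ((sum_eq_zero_iff_of_nonneg hb).1 h.symm i hi)
  have hterm : ∀ i ∈ s, a i * Real.log (A / B) + (a i - b i * (A / B)) ≤
      a i * Real.log (a i / b i) := by
    intro i hi
    rcases (ha i hi).eq_or_lt with h | hai
    · have := mul_nonneg (hb i hi) (div_pos hA0 hB0).le
      simp only [← h, zero_mul, zero_add, zero_sub]
      linarith
    have hbi : 0 < b i := (hb i hi).lt_of_ne fun h => hai.ne' (hab i hi h.symm)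
    have hlog := mul_le_mul_of_nonneg_left
      (Real.log_le_sub_one_of_pos (div_pos (div_pos hA0 hB0) (div_pos hai hbi))) hai.le
    rw [Real.log_div (div_pos hA0 hB0).ne' (div_pos hai hbi).ne'] at hlog
    have : a i * (A / B / (a i / b i) - 1) = b i * (A / B) - a i := by
      field_simp
    linarith
  refine le_trans (le_of_eq ?_) (sum_le_sum hterm)
  rw [sum_add_distrib, sum_sub_distrib, ← sum_mul, ← sum_mul, ← hA, ← hB]
  field_simp
  ring

theorem sum_energy_eq {d N : ℕ} (E : Fin d → ℝ) (x : Fin N → Fin d) :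
    ∑ i, E (x i) = ∑ j, (letterCount x j : ℝ) * E j := by
  simp only [letterCount_eq_sum, Nat.cast_sum, sum_mul]
  rw [sum_comm]
  simp

theorem letterCount_mem_typesOfEnergy {d N : ℕ} {E : Fin d → ℝ} {En : ℝ} {x : Fin N → Fin d}
    (hx : ∑ i, E (x i) = En) : letterCount x ∈ typesOfEnergy d N E En := by
  rw [typesOfEnergy, mem_filter, mem_image]
  refine ⟨⟨fun j => ⟨letterCount x j, ?_⟩, mem_univ _, rfl⟩, sum_letterCount x, ?_⟩
  · exact Nat.lt_succ_of_le ((card_le_univ _).trans (by simp))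
  · rw [← sum_energy_eq, hx]

theorem prefixCount_eq_sum {d N k : ℕ} (hk : k ≤ N) (E : Fin d → ℝ) (En : ℝ)
    (y : Fin k → Fin d) :
    prefixCount d N k hk E En y =
      ∑ n ∈ typesOfEnergy d N E En, (typePrefix hk n y).card := by
  rw [prefixCount, card_eq_sum_card_fiberwise (f := fun x => letterCount x)
    (t := typesOfEnergy d N E En)]
  · refine sum_congr rfl fun n hn => ?_
    congr 1
    ext x
    simp only [typePrefix, mem_filter, mem_univ, true_and]
    constructor
    · rintro ⟨⟨_, h⟩, rfl⟩
      exact ⟨fun _ => rfl, h⟩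
    · rintro ⟨h, hy⟩
      obtain rfl : letterCount x = n := funext h
      exact ⟨⟨(sum_energy_eq E x).trans (mem_filter.1 hn).2.2, hy⟩, rfl⟩
  · intro x hx
    exact letterCount_mem_typesOfEnergy (by simpa using (mem_filter.1 hx).2.1)

theorem prefixCount_div_gE {d N k : ℕ} (hk : k ≤ N) (E : Fin d → ℝ) (En : ℝ)
    (y : Fin k → Fin d) :
    (prefixCount d N k hk E En y : ℝ) / gE d N E En =
      ∑ n ∈ typesOfEnergy d N E En, muE d N E En n * drawProb N n k y := by
  rw [prefixCount_eq_sum, Nat.cast_sum, sum_div]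
  refine sum_congr rfl fun n _ => ?_
  rw [card_typePrefix_eq, muE]
  ring

end

/-- **Relative-entropy bound for marginals of energy-shell states**
(sampling without vs. with replacement). -/
theorem relEntropy_shellMarginal_le
    (d : ℕ) (hd : 2 ≤ d) (E : Fin d → ℝ) (N k : ℕ) (hN : 2 ≤ N)
    (hk1 : 1 ≤ k) (hkN : k ≤ N) (En : ℝ) (hach : 0 < gE d N E En) :
    (∑ y : Fin k → Fin d,
        ((prefixCount d N k hkN E En y : ℝ) / (gE d N E En : ℝ)) *
          Real.log (((prefixCount d N k hkN E En y : ℝ) / (gE d N E En : ℝ)) /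
            (∑ n ∈ typesOfEnergy d N E En, muE d N E En n * ∏ i, (n (y i) : ℝ) / N)))
      ≤ ((d : ℝ) - 1) * k * ((k : ℝ) - 1) / (2 * ((N : ℝ) - 1) * ((N : ℝ) - k + 1)) := by
  have hN0 : (0 : ℝ) < N := by exact_mod_cast (by omega : 0 < N)
  have hg : (0 : ℝ) < gE d N E En := by exact_mod_cast hach
  have hmu : ∀ n, 0 ≤ muE d N E En n := fun n => by
    rw [muE]
    positivity
  have hmu_sum : ∑ n ∈ typesOfEnergy d N E En, muE d N E En n = 1 := by
    simp only [muE]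
    rw [← Finset.sum_div, ← Nat.cast_sum]
    exact div_self hg.ne'
  have hT : ∀ n, muE d N E En n ≠ 0 → 0 < typeClassCard d N n := fun n h => by
    refine Nat.pos_of_ne_zero fun h0 => h ?_
    simp [muE, h0]
  have hconv : ∀ y : Fin k → Fin d,
      ((prefixCount d N k hkN E En y : ℝ) / (gE d N E En : ℝ)) *
          Real.log (((prefixCount d N k hkN E En y : ℝ) / (gE d N E En : ℝ)) /
            (∑ n ∈ typesOfEnergy d N E En, muE d N E En n * ∏ i, (n (y i) : ℝ) / N)) ≤
        ∑ n ∈ typesOfEnergy d N E En, muE d N E En n *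
          (drawProb N n k y * Real.log (drawProb N n k y / ∏ i, (n (y i) : ℝ) / N)) := by
    intro y
    rw [prefixCount_div_gE]
    refine (sum_mul_log_div_sum_le _ _ _ ?_ ?_ ?_).trans (le_of_eq ?_)
    · intro n _
      by_cases h : muE d N E En n = 0
      · simp [h]
      · exact mul_nonneg (hmu n) (drawProb_nonneg hkN n (hT n h) y)
    · intro n _
      exact mul_nonneg (hmu n) (by positivity)
    · intro n _ h0
      by_contra hne
      obtain ⟨h1, h2⟩ := mul_ne_zero_iff.1 hne
      refine mul_ne_zero h1 (Finset.prod_ne_zero_iff.2 fun i _ => ?_) h0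
      have := pos_of_drawProb_ne_zero hkN n (hT n h1) h2 i
      positivity
    · refine Finset.sum_congr rfl fun n _ => ?_
      by_cases h : muE d N E En n = 0
      · simp [h]
      · rw [mul_div_mul_left _ _ h, mul_assoc]
  refine (Finset.sum_le_sum fun y _ => hconv y).trans ?_
  rw [Finset.sum_comm]
  simp only [← Finset.mul_sum]
  calc _ ≤ ∑ n ∈ typesOfEnergy d N E En, muE d N E En n *
        (((d : ℝ) - 1) * k * ((k : ℝ) - 1) / (2 * ((N : ℝ) - 1) * ((N : ℝ) - k + 1))) := by
        refine Finset.sum_le_sum fun n hn => ?_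
        by_cases h : muE d N E En n = 0
        · simp [h]
        · exact mul_le_mul_of_nonneg_left
            ((relEntropy_drawProb_le hN hkN n (Finset.mem_filter.1 hn).2.1 (hT n h)).trans
              (sum_range_mul_div_le (by omega) hN hkN)) (hmu n)
    _ = _ := by rw [← Finset.sum_mul, hmu_sum, one_mul]

end
end

section
/- Structure theorem for EPU-invariant states. Fix d ≥ 2, N ≥ 1 and E : Fin d → ℝ, and let H be the diagonal N-qudit Hamiltonian with H(x,x) = Σ_{j<N} E(x j). A density matrix ρ on N qudits satisfies U ρ U† = ρ for every unitary U with U·H = H·U if and only if ρ = Σ_Е (tr(P_Е ρ)/g(Е))·P_Е, where the sum ranges over the achievable total energies Е (i.e., ρ is a convex mixture of the normalized shell projectors P_Е/g(Е)). -/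
open scoped Classical ComplexOrder
open Matrix

noncomputable section

/-- Strings of `N` qudits with `d` levels. -/
abbrev QString (d N : ℕ) := Fin N → Fin d

/-- Matrices on `N` qudits. -/
abbrev QMat (d N : ℕ) := Matrix (QString d N) (QString d N) ℂ

/-- Total energy of a basis string. -/
def totalEnergy {d N : ℕ} (E : Fin d → ℝ) (x : QString d N) : ℝ := ∑ j, E (x j)

/-- The noninteracting total Hamiltonian (diagonal in the energy eigenbasis). -/
def Hqudit (d N : ℕ) (E : Fin d → ℝ) : QMat d N :=
  Matrix.diagonal fun x => (totalEnergy E x : ℂ)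

/-- The projector onto the shell of total energy `En`. -/
def shellProj (d N : ℕ) (E : Fin d → ℝ) (En : ℝ) : QMat d N :=
  Matrix.diagonal fun x => if totalEnergy E x = En then (1 : ℂ) else 0

/-- `g(En)`: the number of basis strings of total energy `En` (the trace of `shellProj`). -/
def shellDim (d N : ℕ) (E : Fin d → ℝ) (En : ℝ) : ℕ :=
  (Finset.univ.filter fun x : QString d N => totalEnergy E x = En).card

/-- The finite set of achievable total energies. -/
def energyLevels (d N : ℕ) (E : Fin d → ℝ) : Finset ℝ :=
  Finset.univ.image fun x : QString d N => totalEnergy E x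

/-- A density matrix: positive semidefinite with unit trace. -/
def IsDensityMatrix {n : Type*} [Fintype n] [DecidableEq n] (ρ : Matrix n n ℂ) : Prop :=
  ρ.PosSemidef ∧ ρ.trace = 1

/-- Invariance under every energy-preserving unitary. -/
def IsEPUInvariant (d N : ℕ) (E : Fin d → ℝ) (ρ : QMat d N) : Prop :=
  ∀ U : QMat d N, U ∈ Matrix.unitaryGroup (QString d N) ℂ →
    U * Hqudit d N E = Hqudit d N E * U → U * ρ * Uᴴ = ρ

theorem commute_Hqudit_iff {d N : ℕ} {E : Fin d → ℝ} {U : QMat d N} :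
    U * Hqudit d N E = Hqudit d N E * U ↔
      ∀ x y, totalEnergy E x ≠ totalEnergy E y → U x y = 0 := by
  constructor
  · intro h x y hxy
    have hentry := congrFun (congrFun h x) y
    rw [Hqudit, Matrix.mul_diagonal, Matrix.diagonal_mul, mul_comm] at hentry
    by_contra hU
    exact hxy (by exact_mod_cast (mul_right_cancel₀ hU hentry).symm)
  · intro h
    ext x y
    rw [Hqudit, Matrix.mul_diagonal, Matrix.diagonal_mul]
    by_cases hxy : totalEnergy E x = totalEnergy E y
    · rw [hxy, mul_comm]
    · simp [h x y hxy]

/-- An energy-preserving matrix commutes with every shell projector. -/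
theorem commute_shellProj {d N : ℕ} {E : Fin d → ℝ} {U : QMat d N}
    (hU : U * Hqudit d N E = Hqudit d N E * U) (En : ℝ) :
    U * shellProj d N E En = shellProj d N E En * U := by
  ext x y
  rw [shellProj, Matrix.mul_diagonal, Matrix.diagonal_mul]
  by_cases hxy : totalEnergy E x = totalEnergy E y
  · rw [hxy, mul_comm]
  · simp [commute_Hqudit_iff.1 hU x y hxy]

theorem trace_shellProj_mul {d N : ℕ} (E : Fin d → ℝ) (En : ℝ) (ρ : QMat d N) :
    (shellProj d N E En * ρ).trace =
      ∑ x ∈ Finset.univ.filter fun x : QString d N => totalEnergy E x = En, ρ x x := by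
  simp [Matrix.trace, shellProj, Matrix.diagonal_mul, Finset.sum_filter]

theorem sum_smul_shellProj {d N : ℕ} (E : Fin d → ℝ) (c : ℝ → ℂ) :
    ∑ En ∈ energyLevels d N E, c En • shellProj d N E En =
      Matrix.diagonal fun x => c (totalEnergy E x) := by
  ext x y
  rw [Matrix.sum_apply]
  by_cases hxy : x = y
  · subst hxy
    simp [shellProj, energyLevels]
  · simp [shellProj, hxy]

/-- Invariance under diagonal sign flips kills the off-diagonal entries. -/
theorem IsEPUInvariant.apply_eq_zero {d N : ℕ} {E : Fin d → ℝ} {ρ : QMat d N}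
    (h : IsEPUInvariant d N E ρ) {x y : QString d N} (hxy : x ≠ y) : ρ x y = 0 := by
  let v : QString d N → ℂ := fun z => if z = x then -1 else 1
  have hU : Matrix.diagonal v ∈ Matrix.unitaryGroup (QString d N) ℂ := by
    rw [Matrix.mem_unitaryGroup_iff, Matrix.star_eq_conjTranspose, Matrix.diagonal_conjTranspose,
      Matrix.diagonal_mul_diagonal, ← Matrix.diagonal_one]
    congr 1
    ext z
    by_cases hz : z = x <;> simp [v, hz]
  have hcomm : Matrix.diagonal v * Hqudit d N E = Hqudit d N E * Matrix.diagonal v :=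
    Matrix.commute_diagonal _ _
  have hentry := congrFun (congrFun (h _ hU hcomm) x) y
  rw [Matrix.diagonal_conjTranspose, Matrix.mul_diagonal, Matrix.diagonal_mul] at hentry
  simpa [v, hxy.symm, neg_eq_self] using hentry

/-- Invariance under transpositions within a shell makes the diagonal constant on shells. -/
theorem IsEPUInvariant.diag_eq {d N : ℕ} {E : Fin d → ℝ} {ρ : QMat d N}
    (h : IsEPUInvariant d N E ρ) {x y : QString d N}
    (hxy : totalEnergy E x = totalEnergy E y) : ρ x x = ρ y y := by
  let σ : Equiv.Perm (QString d N) := Equiv.swap x y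
  have hσ : ∀ z, totalEnergy E (σ z) = totalEnergy E z := by
    intro z
    simp only [σ, Equiv.swap_apply_def]
    split_ifs with hx hy <;> simp_all
  have hU : σ.permMatrix ℂ ∈ Matrix.unitaryGroup (QString d N) ℂ := by
    rw [Matrix.mem_unitaryGroup_iff, Matrix.star_eq_conjTranspose, Matrix.conjTranspose_permMatrix,
      ← Matrix.permMatrix_mul, inv_mul_cancel, Matrix.permMatrix_one]
  have hcomm : σ.permMatrix ℂ * Hqudit d N E = Hqudit d N E * σ.permMatrix ℂ := by
    refine commute_Hqudit_iff.2 fun a b hab => ?_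
    have hne : σ a ≠ b := by
      rintro rfl
      exact hab (hσ a).symm
    simp [PEquiv.toMatrix_apply, hne]
  have hentry := congrFun (congrFun (h _ hU hcomm) x) x
  rw [Matrix.conjTranspose_permMatrix, PEquiv.toMatrix_toPEquiv_mul,
    PEquiv.mul_toMatrix_toPEquiv] at hentry
  simpa [σ] using hentry.symm

/-- **Structure theorem for EPU-invariant states.** -/
theorem EPUInvariant_iff_mixture_of_shells (d N : ℕ) (hd : 2 ≤ d) (hN : 1 ≤ N)
    (E : Fin d → ℝ) (ρ : QMat d N) (hρ : IsDensityMatrix ρ) :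
    IsEPUInvariant d N E ρ ↔
      ρ = ∑ En ∈ energyLevels d N E,
        ((shellProj d N E En * ρ).trace / (shellDim d N E En : ℂ)) • shellProj d N E En := by
  constructor
  · intro h
    rw [sum_smul_shellProj E fun En =>
      (shellProj d N E En * ρ).trace / (shellDim d N E En : ℂ)]
    ext x y
    by_cases hxy : x = y
    · subst hxy
      have hpos : (shellDim d N E (totalEnergy E x) : ℂ) ≠ 0 := by
        rw [Nat.cast_ne_zero, shellDim]
        exact Finset.card_ne_zero_of_mem (a := x) (by simp)
      have htrace : (shellProj d N E (totalEnergy E x) * ρ).trace =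
          shellDim d N E (totalEnergy E x) * ρ x x := by
        rw [trace_shellProj_mul, shellDim, ← nsmul_eq_mul]
        exact Finset.sum_eq_card_nsmul fun z hz => h.diag_eq (Finset.mem_filter.1 hz).2
      rw [Matrix.diagonal_apply_eq, htrace, mul_div_cancel_left₀ _ hpos]
    · rw [Matrix.diagonal_apply_ne _ hxy, h.apply_eq_zero hxy]
  · intro h U hU hcomm
    have hUρ : U * ρ = ρ * U := by
      rw [h, Finset.mul_sum, Finset.sum_mul]
      refine Finset.sum_congr rfl fun En _ => ?_
      rw [Matrix.mul_smul, Matrix.smul_mul, commute_shellProj hcomm]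
    rw [hUρ, Matrix.mul_assoc, ← Matrix.star_eq_conjTranspose,
      Matrix.mem_unitaryGroup_iff.1 hU, Matrix.mul_one]

end
end

section
/- Existence and uniqueness of the inverse temperature matching a prescribed mean energy. Let d ≥ 2 and let E : Fin d → ℝ be nonconstant. For every real number e with min_j E(j) < e < max_j E(j), there exists a unique β ∈ ℝ such that Σ_j E(j)·e^{−β·E(j)} = e · Σ_j e^{−β·E(j)}; equivalently, the Gibbs distribution P_β(j) = e^{−βE(j)}/Σ_i e^{−βE(i)} has mean energy Σ_j E(j)·P_β(j) = e. -/
noncomputable section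

theorem mul_exp_mul_strictMono {a : ℝ} (ha : a ≠ 0) :
    StrictMono fun β : ℝ => a * Real.exp (β * a) := by
  intro x y hxy
  rcases ha.lt_or_gt with h | h
  · exact mul_lt_mul_of_neg_left (Real.exp_lt_exp.2 (mul_lt_mul_of_neg_right hxy h)) h
  · exact mul_lt_mul_of_pos_left (Real.exp_lt_exp.2 (mul_lt_mul_of_pos_right hxy h)) h

theorem mul_exp_mul_monotone (a : ℝ) : Monotone fun β : ℝ => a * Real.exp (β * a) := by
  rcases eq_or_ne a 0 with rfl | ha
  · simp [monotone_const]
  · exact (mul_exp_mul_strictMono ha).monotone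

theorem sum_mul_exp_mul_strictMono {ι : Type*} [Fintype ι] {a : ι → ℝ} (h : ∃ k, a k ≠ 0) :
    StrictMono fun β : ℝ => ∑ j, a j * Real.exp (β * a j) := by
  obtain ⟨k, hk⟩ := h
  intro x y hxy
  exact Finset.sum_lt_sum (fun j _ => mul_exp_mul_monotone (a j) hxy.le)
    ⟨k, Finset.mem_univ k, mul_exp_mul_strictMono hk hxy⟩

theorem exists_sum_mul_exp_mul_nonneg {ι : Type*} [Fintype ι] {a : ι → ℝ} (h : ∃ k, 0 < a k) :
    ∃ β : ℝ, 0 ≤ ∑ j, a j * Real.exp (β * a j) := by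
  classical
  obtain ⟨k, hk⟩ := h
  set β : ℝ := |∑ j, a j| / a k ^ 2 with hβ
  have hβ_nonneg : 0 ≤ β := by positivity
  have hβ_mul : β * a k ^ 2 = |∑ j, a j| := by rw [hβ]; field_simp
  have hterm : ∀ j, a j + (if j = k then β * a k ^ 2 else 0) ≤ a j * Real.exp (β * a j) := by
    intro j
    split_ifs with hj
    · subst hj
      nlinarith [mul_le_mul_of_nonneg_left (Real.add_one_le_exp (β * a j)) hk.le]
    · simpa using mul_exp_mul_monotone (a j) hβ_nonneg
  refine ⟨β, le_trans ?_ (Finset.sum_le_sum fun j _ => hterm j)⟩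
  rw [Finset.sum_add_distrib, Finset.sum_ite_eq' Finset.univ k, if_pos (Finset.mem_univ k), hβ_mul]
  linarith [neg_abs_le (∑ j, a j)]

theorem existsUnique_sum_mul_exp_mul_eq_zero {ι : Type*} [Fintype ι] {a : ι → ℝ}
    (hneg : ∃ k, a k < 0) (hpos : ∃ k, 0 < a k) :
    ∃! β : ℝ, ∑ j, a j * Real.exp (β * a j) = 0 := by
  have hcont : Continuous fun β : ℝ => ∑ j, a j * Real.exp (β * a j) := by fun_prop
  have hle : ∃ β : ℝ, ∑ j, a j * Real.exp (β * a j) ≤ 0 := by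
    obtain ⟨β, hβ⟩ := exists_sum_mul_exp_mul_nonneg (a := fun j => -a j)
      (hneg.imp fun _ hk => neg_pos.2 hk)
    refine ⟨-β, ?_⟩
    simpa using hβ
  obtain ⟨β, hβ⟩ := mem_range_of_exists_le_of_exists_ge hcont hle
    (exists_sum_mul_exp_mul_nonneg hpos)
  exact ⟨β, hβ, fun γ hγ =>
    (sum_mul_exp_mul_strictMono (hpos.imp fun _ hk => hk.ne')).injective (hγ.trans hβ.symm)⟩

/-- **Existence and uniqueness of the inverse temperature matching a prescribed mean
energy**: if `E` is nonconstant and `min_j E j < e < max_j E j`, there is a unique `β`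
with `Σ_j E j · e^{−βE j} = e · Σ_j e^{−βE j}`, i.e. the Gibbs distribution at inverse
temperature `β` has mean energy `e`. -/
theorem existsUnique_inverse_temperature
    (d : ℕ) (hd : 2 ≤ d) (E : Fin d → ℝ) (hE : ∃ j j', E j ≠ E j')
    (e : ℝ) (hlo : ∃ j, E j < e) (hhi : ∃ j, e < E j) :
    ∃! β : ℝ,
      (∑ j, E j * Real.exp (-β * E j)) = e * ∑ j, Real.exp (-β * E j) := by
  have hiff : ∀ β : ℝ, (∑ j, E j * Real.exp (-β * E j)) = e * ∑ j, Real.exp (-β * E j) ↔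
      ∑ j, (e - E j) * Real.exp (β * (e - E j)) = 0 := by
    intro β
    have hfactor : ∑ j, (e - E j) * Real.exp (β * (e - E j)) = Real.exp (β * e) *
        (e * ∑ j, Real.exp (-β * E j) - ∑ j, E j * Real.exp (-β * E j)) := by
      rw [Finset.mul_sum, ← Finset.sum_sub_distrib, Finset.mul_sum]
      refine Finset.sum_congr rfl fun j _ => ?_
      rw [show β * (e - E j) = β * e + -β * E j by ring, Real.exp_add]
      ring
    rw [hfactor, mul_eq_zero, or_iff_right (Real.exp_ne_zero _), sub_eq_zero, eq_comm]
  simp only [hiff]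
  exact existsUnique_sum_mul_exp_mul_eq_zero (hhi.imp fun _ => sub_neg.2)
    (hlo.imp fun _ => sub_pos.2)

end
end

section
/- Commutation of the two Lindblad dissipators: for every complex D×D matrix ρ, L_block(L_deph(ρ)) = L_deph(L_block(ρ)). -/
open Matrix

noncomputable section

/-- The block-randomizing dissipator
`L_block(ρ) = Σ_s γ_s [ (tr(P_s ρ P_s)/g(s)) P_s − P_s ρ P_s ]`, with `g(s) = tr P_s`. -/
def Lblock {ι D : Type*} [Fintype ι] [Fintype D]
    (P : ι → Matrix D D ℂ) (γ : ι → ℝ) (ρ : Matrix D D ℂ) : Matrix D D ℂ :=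
  ∑ s, (γ s : ℂ) • (((P s * ρ * P s).trace / (P s).trace) • P s - P s * ρ * P s)

/-- The dephasing dissipator `L_deph(ρ) = Σ_s λ_s [ P_s ρ P_s − (P_s ρ + ρ P_s)/2 ]`. -/
def Ldeph {ι D : Type*} [Fintype ι] [Fintype D]
    (P : ι → Matrix D D ℂ) (lam : ι → ℝ) (ρ : Matrix D D ℂ) : Matrix D D ℂ :=
  ∑ s, (lam s : ℂ) • (P s * ρ * P s - (2⁻¹ : ℂ) • (P s * ρ + ρ * P s))

theorem Ldeph_eq_zero_of_commute {ι D : Type*} [Fintype ι] [Fintype D]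
    {P : ι → Matrix D D ℂ} (hidem : ∀ s, P s * P s = P s) (lam : ι → ℝ) {ρ : Matrix D D ℂ}
    (hcomm : ∀ s, Commute (P s) ρ) : Ldeph P lam ρ = 0 := by
  refine Finset.sum_eq_zero fun s _ => ?_
  have h : P s * ρ * P s = P s * ρ := by
    rw [Matrix.mul_assoc, ← (hcomm s).eq, ← Matrix.mul_assoc, hidem]
  rw [h, ← (hcomm s).eq, ← two_smul ℂ, smul_smul]
  simp

theorem commute_Lblock {ι D : Type*} [Fintype ι] [DecidableEq ι] [Fintype D]
    {P : ι → Matrix D D ℂ} (horth : ∀ s s', P s * P s' = if s = s' then P s else 0)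
    (γ : ι → ℝ) (ρ : Matrix D D ℂ) (t : ι) : Commute (P t) (Lblock P γ ρ) := by
  refine Commute.sum_right _ _ _ fun s _ => ?_
  by_cases hts : t = s
  · subst hts
    refine (((Commute.refl _).smul_right _).sub_right ?_).smul_right _
    have h : P t * P t = P t := by simp [horth]
    rw [Commute, SemiconjBy, Matrix.mul_assoc (P t * ρ), h, ← Matrix.mul_assoc,
      ← Matrix.mul_assoc, h]
  · have h₁ : P t * P s = 0 := by simp [horth, hts]
    have h₂ : P s * P t = 0 := by simp [horth, Ne.symm hts]
    refine (Commute.smul_right ?_ _).sub_right ?_ |>.smul_right _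
    · rw [Commute, SemiconjBy, h₁, h₂]
    · rw [Commute, SemiconjBy, Matrix.mul_assoc (P s * ρ), h₂, ← Matrix.mul_assoc,
        ← Matrix.mul_assoc, h₁]
      simp

theorem mul_Ldeph_mul_self {ι D : Type*} [Fintype ι] [DecidableEq ι] [Fintype D]
    {P : ι → Matrix D D ℂ} (horth : ∀ s s', P s * P s' = if s = s' then P s else 0)
    (lam : ι → ℝ) (ρ : Matrix D D ℂ) (t : ι) : P t * Ldeph P lam ρ * P t = 0 := by
  rw [Ldeph, Matrix.mul_sum, Matrix.sum_mul]
  refine Finset.sum_eq_zero fun s _ => ?_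
  have h : P t * (P s * ρ * P s - (2⁻¹ : ℂ) • (P s * ρ + ρ * P s)) * P t =
      (P t * P s) * ρ * (P s * P t) -
        (2⁻¹ : ℂ) • ((P t * P s) * ρ * P t + P t * ρ * (P s * P t)) := by
    simp only [Matrix.mul_sub, Matrix.sub_mul, Matrix.mul_smul, Matrix.smul_mul,
      Matrix.mul_add, Matrix.add_mul, Matrix.mul_assoc]
  rw [Matrix.mul_smul, Matrix.smul_mul, h, horth, horth]
  by_cases hts : t = s
  · subst hts
    rw [if_pos rfl, ← two_smul ℂ, smul_smul]
    simp
  · simp [hts, Ne.symm hts]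

/-- **Commutation of the two Lindblad dissipators.** -/
theorem Lblock_Ldeph_comm
    {ι D : Type*} [Fintype ι] [Nonempty ι] [DecidableEq ι] [Fintype D] [DecidableEq D]
    (P : ι → Matrix D D ℂ)
    (hherm : ∀ s, (P s)ᴴ = P s)
    (horth : ∀ s s', P s * P s' = if s = s' then P s else 0)
    (hsum : ∑ s, P s = 1)
    (hg : ∀ s, 0 < ((P s).trace).re)
    (γ lam : ι → ℝ) (hγ : ∀ s, 0 ≤ γ s) (hlam : ∀ s, 0 ≤ lam s)
    (ρ : Matrix D D ℂ) :
    Lblock P γ (Ldeph P lam ρ) = Ldeph P lam (Lblock P γ ρ) := by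
  have hidem : ∀ s, P s * P s = P s := fun s => by simp [horth]
  rw [Ldeph_eq_zero_of_commute hidem lam (commute_Lblock horth γ ρ)]
  simp [Lblock, mul_Ldeph_mul_self horth]

end
end

section
/- Explicit solution of the energy-conserving Lindblad dynamics. For a given D×D complex matrix ρ₀, define for t ∈ ℝ: ρ(t) := Σ_s [ e^{−t·γ_s}·P_s ρ₀ P_s + (1 − e^{−t·γ_s})·tr(P_s ρ₀)·P_s/g(s) ] + Σ_{s ≠ s'} e^{−(λ_s + λ_{s'})·t/2}·P_s ρ₀ P_{s'}. Then ρ(0) = ρ₀ and for every t ∈ ℝ the matrix-valued function ρ(·) has derivative at t equal to L(ρ(t)) := L_block(ρ(t)) + L_deph(ρ(t)). -/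
open Matrix

noncomputable section

/-- The explicit solution of the energy-conserving Lindblad dynamics. -/
def lindbladSol {ι D : Type*} [Fintype ι] [DecidableEq ι] [Fintype D]
    (P : ι → Matrix D D ℂ) (γ lam : ι → ℝ) (ρ₀ : Matrix D D ℂ) (t : ℝ) :
    Matrix D D ℂ :=
  (∑ s, (((Real.exp (-t * γ s)) : ℝ) : ℂ) • (P s * ρ₀ * P s)
    + ∑ s, (((1 - Real.exp (-t * γ s)) : ℝ) : ℂ) • (((P s * ρ₀).trace / (P s).trace) • P s))
  + ∑ s, ∑ s', if s = s' then 0 else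
      (((Real.exp (-(lam s + lam s') * t / 2)) : ℝ) : ℂ) • (P s * ρ₀ * P s')

attribute [local instance] Matrix.normedAddCommGroup Matrix.normedSpace

/-- The `(a, b)` block of the explicit solution, once the solution is written as a sum over all
pairs of indices. -/
def lindbladBlock {ι D : Type*} [DecidableEq ι] [Fintype D]
    (P : ι → Matrix D D ℂ) (γ lam : ι → ℝ) (ρ₀ : Matrix D D ℂ) (t : ℝ) (a b : ι) :
    Matrix D D ℂ :=
  if a = b then
    ((Real.exp (-t * γ a) : ℝ) : ℂ) • (P a * ρ₀ * P a)
      + ((1 - Real.exp (-t * γ a) : ℝ) : ℂ) • (((P a * ρ₀).trace / (P a).trace) • P a)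
  else ((Real.exp (-(lam a + lam b) * t / 2) : ℝ) : ℂ) • (P a * ρ₀ * P b)

theorem lindbladSol_eq_sum_lindbladBlock {ι D : Type*} [Fintype ι] [DecidableEq ι] [Fintype D]
    (P : ι → Matrix D D ℂ) (γ lam : ι → ℝ) (ρ₀ : Matrix D D ℂ) (t : ℝ) :
    lindbladSol P γ lam ρ₀ t = ∑ a, ∑ b, lindbladBlock P γ lam ρ₀ t a b := by
  rw [lindbladSol, ← Finset.sum_add_distrib, ← Finset.sum_add_distrib]
  refine Finset.sum_congr rfl fun a _ => ?_
  rw [← Finset.add_sum_erase _ _ (Finset.mem_univ a),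
    ← Finset.add_sum_erase (a := a) _ (lindbladBlock P γ lam ρ₀ t a) (Finset.mem_univ a)]
  simp only [lindbladBlock, if_true, zero_add]
  congr 1
  refine Finset.sum_congr rfl fun b hb => ?_
  have hab : a ≠ b := (Finset.ne_of_mem_erase hb).symm
  simp [hab]

theorem sum_sum_mul_mul_of_sum_eq_one {ι R : Type*} [Fintype ι] [Semiring R]
    {P : ι → R} (hsum : ∑ s, P s = 1) (x : R) :
    ∑ a, ∑ b, P a * x * P b = x := by
  simp_rw [← Finset.mul_sum, hsum, mul_one, ← Finset.sum_mul, hsum, one_mul]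

section

variable {ι D : Type*} [DecidableEq ι] [Fintype D] {P : ι → Matrix D D ℂ}

theorem mul_lindbladBlock_mul
    (horth : ∀ s s', P s * P s' = if s = s' then P s else 0)
    (γ lam : ι → ℝ) (ρ₀ : Matrix D D ℂ) (t : ℝ) (a b c d : ι) :
    P a * lindbladBlock P γ lam ρ₀ t c d * P b =
      if a = c ∧ d = b then lindbladBlock P γ lam ρ₀ t c d else 0 := by
  have left : P a * lindbladBlock P γ lam ρ₀ t c d =
      if a = c then lindbladBlock P γ lam ρ₀ t c d else 0 := by
    unfold lindbladBlock
    by_cases hac : a = c <;> by_cases hcd : c = d <;>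
      simp_all [mul_add, ← mul_assoc]
  have right : lindbladBlock P γ lam ρ₀ t c d * P b =
      if d = b then lindbladBlock P γ lam ρ₀ t c d else 0 := by
    unfold lindbladBlock
    by_cases hdb : d = b <;> by_cases hcd : c = d <;>
      simp_all [add_mul, mul_assoc]
  rw [left]
  by_cases hac : a = c <;> simp [hac, right]

theorem mul_lindbladSol_mul [Fintype ι]
    (horth : ∀ s s', P s * P s' = if s = s' then P s else 0)
    (γ lam : ι → ℝ) (ρ₀ : Matrix D D ℂ) (t : ℝ) (a b : ι) :
    P a * lindbladSol P γ lam ρ₀ t * P b = lindbladBlock P γ lam ρ₀ t a b := by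
  rw [lindbladSol_eq_sum_lindbladBlock]
  simp [Finset.mul_sum, Finset.sum_mul, mul_lindbladBlock_mul horth, ite_and]

theorem trace_mul_mul_of_idempotent {Q : Matrix D D ℂ} (hQ : Q * Q = Q) (ρ : Matrix D D ℂ) :
    (Q * ρ * Q).trace = (Q * ρ).trace := by
  rw [Matrix.trace_mul_comm, ← mul_assoc, hQ]

theorem trace_lindbladBlock_self
    (horth : ∀ s s', P s * P s' = if s = s' then P s else 0)
    (γ lam : ι → ℝ) (ρ₀ : Matrix D D ℂ) (t : ℝ) {a : ι} (ha : (P a).trace ≠ 0) :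
    (lindbladBlock P γ lam ρ₀ t a a).trace = (P a * ρ₀).trace := by
  simp only [lindbladBlock, if_true, Matrix.trace_add, Matrix.trace_smul, smul_eq_mul,
    trace_mul_mul_of_idempotent (by simpa using horth a a : P a * P a = P a),
    div_mul_cancel₀ _ ha]
  push_cast
  ring

theorem hasDerivAt_lindbladBlock
    (γ lam : ι → ℝ) (ρ₀ : Matrix D D ℂ) (t : ℝ) (a b : ι) :
    HasDerivAt (fun t => lindbladBlock P γ lam ρ₀ t a b)
      (if a = b then
        (γ a : ℂ) • (((P a * ρ₀).trace / (P a).trace) • P a - lindbladBlock P γ lam ρ₀ t a a)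
      else (-(lam a + lam b) / 2 : ℂ) • lindbladBlock P γ lam ρ₀ t a b) t := by
  by_cases hab : a = b
  · subst hab
    have he : HasDerivAt (fun t : ℝ => Real.exp (-t * γ a)) (Real.exp (-t * γ a) * (-1 * γ a)) t :=
      ((hasDerivAt_id t).neg.mul_const (γ a)).exp
    simp only [lindbladBlock, if_true]
    refine ((he.ofReal_comp.smul_const (P a * ρ₀ * P a)).add
      ((he.const_sub 1).ofReal_comp.smul_const
        (((P a * ρ₀).trace / (P a).trace) • P a))).congr_deriv ?_
    push_cast
    module
  · have he : HasDerivAt (fun t : ℝ => Real.exp (-(lam a + lam b) * t / 2))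
        (Real.exp (-(lam a + lam b) * t / 2) * (-(lam a + lam b) * 1 / 2)) t :=
      (((hasDerivAt_id t).const_mul _).div_const 2).exp
    simp only [lindbladBlock, if_neg hab]
    refine (he.ofReal_comp.smul_const (P a * ρ₀ * P b)).congr_deriv ?_
    push_cast
    module

theorem Ldeph_eq_sum [Fintype ι] [DecidableEq D] (hsum : ∑ s, P s = 1)
    (lam : ι → ℝ) (ρ : Matrix D D ℂ) :
    Ldeph P lam ρ =
      ∑ a, ∑ b, if a = b then 0 else (-(lam a + lam b) / 2 : ℂ) • (P a * ρ * P b) := by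
  have hl (s : ι) : P s * ρ = ∑ b, P s * ρ * P b := by rw [← Finset.mul_sum, hsum, mul_one]
  have hr (s : ι) : ρ * P s = ∑ a, P a * ρ * P s := by
    rw [← Finset.sum_mul, ← Finset.sum_mul, hsum, one_mul]
  have hterm (a b : ι) :
      (if a = b then 0 else (-(lam a + lam b) / 2 : ℂ) • (P a * ρ * P b)) =
        (if a = b then (lam a : ℂ) • (P a * ρ * P b) else 0)
          - (2⁻¹ * lam a : ℂ) • (P a * ρ * P b) - (2⁻¹ * lam b : ℂ) • (P a * ρ * P b) := by
    split_ifs with h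
    · subst h; module
    · module
  simp_rw [hterm, Finset.sum_sub_distrib]
  rw [Finset.sum_comm (f := fun a b => (2⁻¹ * lam b : ℂ) • (P a * ρ * P b))]
  simp_rw [← Finset.smul_sum, ← hl, ← hr, Finset.sum_ite_eq, Finset.mem_univ, if_true,
    ← Finset.sum_sub_distrib, Ldeph]
  exact Finset.sum_congr rfl fun s _ => by module

end

/-- **Explicit solution of the energy-conserving Lindblad dynamics**: `ρ(0) = ρ₀` and
`ρ'(t) = L_block(ρ(t)) + L_deph(ρ(t))` for all `t`. -/
theorem lindbladSol_hasDerivAt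
    {ι D : Type*} [Fintype ι] [Nonempty ι] [DecidableEq ι] [Fintype D] [DecidableEq D]
    (P : ι → Matrix D D ℂ)
    (hherm : ∀ s, (P s)ᴴ = P s)
    (horth : ∀ s s', P s * P s' = if s = s' then P s else 0)
    (hsum : ∑ s, P s = 1)
    (hg : ∀ s, 0 < ((P s).trace).re)
    (γ lam : ι → ℝ) (hγ : ∀ s, 0 ≤ γ s) (hlam : ∀ s, 0 ≤ lam s)
    (ρ₀ : Matrix D D ℂ) :
    lindbladSol P γ lam ρ₀ 0 = ρ₀ ∧
    ∀ t : ℝ, HasDerivAt (lindbladSol P γ lam ρ₀)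
      (Lblock P γ (lindbladSol P γ lam ρ₀ t) + Ldeph P lam (lindbladSol P γ lam ρ₀ t)) t := by
  have htr (s : ι) : (P s).trace ≠ 0 := fun h => by simpa [h] using hg s
  refine ⟨?_, fun t => ?_⟩
  · rw [lindbladSol_eq_sum_lindbladBlock]
    conv_rhs => rw [← sum_sum_mul_mul_of_sum_eq_one hsum ρ₀]
    refine Finset.sum_congr rfl fun a _ => Finset.sum_congr rfl fun b _ => ?_
    by_cases hab : a = b <;> simp [lindbladBlock, hab]
  · have hsol : lindbladSol P γ lam ρ₀ = fun t => ∑ a, ∑ b, lindbladBlock P γ lam ρ₀ t a b :=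
      funext (lindbladSol_eq_sum_lindbladBlock P γ lam ρ₀)
    have hderiv := HasDerivAt.fun_sum (u := Finset.univ) fun a _ =>
      HasDerivAt.fun_sum (u := Finset.univ) fun b _ =>
        hasDerivAt_lindbladBlock (P := P) γ lam ρ₀ t a b
    rw [← hsol] at hderiv
    refine hderiv.congr_deriv ?_
    rw [Ldeph_eq_sum hsum, Lblock, ← Finset.sum_add_distrib]
    simp_rw [mul_lindbladSol_mul horth, trace_lindbladBlock_self horth γ lam ρ₀ t (htr _)]
    refine Finset.sum_congr rfl fun a _ => ?_
    rw [← Finset.add_sum_erase _ _ (Finset.mem_univ a), if_pos rfl]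
    congr 1
    rw [← Finset.add_sum_erase (a := a) Finset.univ (fun b => if a = b then 0 else _)
      (Finset.mem_univ a), if_pos rfl, zero_add]
    refine Finset.sum_congr rfl fun b hb => ?_
    have hab : a ≠ b := (Finset.ne_of_mem_erase hb).symm
    simp only [if_neg hab]

end
end

section
/- Spectral action of the Lindblad generator. Let L := L_block + L_deph. Then: (i) for every D×D matrix ρ, the twirled matrix T(ρ) := Σ_s tr(P_s ρ)·P_s/g(s) satisfies L(T(ρ)) = 0 (in particular L(P_s) = 0 for each s); (ii) if a matrix F satisfies P_s F P_s = F for some s and tr F = 0, then L(F) = −γ_s·F; (iii) if s ≠ s' and a matrix X satisfies P_s X P_{s'} = X, then L(X) = −((λ_s + λ_{s'})/2)·X. -/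
open Matrix

noncomputable section

/-- The twirl `T(ρ) = Σ_s tr(P_s ρ) P_s / g(s)`. -/
def twirl {ι D : Type*} [Fintype ι] [Fintype D]
    (P : ι → Matrix D D ℂ) (ρ : Matrix D D ℂ) : Matrix D D ℂ :=
  ∑ s, ((P s * ρ).trace / (P s).trace) • P s

theorem Lblock_add_Ldeph_eq_zero_of_mul_eq_smul {ι D : Type*} [Fintype ι] [Fintype D]
    (P : ι → Matrix D D ℂ) (hidem : ∀ s, P s * P s = P s) (htr : ∀ s, (P s).trace ≠ 0)
    (γ lam : ι → ℝ) (ρ : Matrix D D ℂ) (c : ι → ℂ)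
    (hl : ∀ s, P s * ρ = c s • P s) (hr : ∀ s, ρ * P s = c s • P s) :
    Lblock P γ ρ + Ldeph P lam ρ = 0 := by
  have hb : Lblock P γ ρ = 0 := by
    refine Finset.sum_eq_zero fun s _ => ?_
    rw [hl, Matrix.smul_mul, hidem, Matrix.trace_smul, smul_eq_mul,
      mul_div_cancel_right₀ _ (htr s), sub_self, smul_zero]
  have hd : Ldeph P lam ρ = 0 := by
    refine Finset.sum_eq_zero fun s _ => ?_
    rw [hl, hr, Matrix.smul_mul, hidem, ← two_smul ℂ (c s • P s), smul_smul,
      inv_mul_cancel₀ two_ne_zero, one_smul, sub_self, smul_zero]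
  rw [hb, hd, add_zero]

theorem mul_twirl {ι D : Type*} [Fintype ι] [DecidableEq ι] [Fintype D]
    (P : ι → Matrix D D ℂ) (horth : ∀ s s', P s * P s' = if s = s' then P s else 0)
    (ρ : Matrix D D ℂ) (s : ι) :
    P s * twirl P ρ = ((P s * ρ).trace / (P s).trace) • P s := by
  simp [twirl, Finset.mul_sum, horth]

theorem twirl_mul {ι D : Type*} [Fintype ι] [DecidableEq ι] [Fintype D]
    (P : ι → Matrix D D ℂ) (horth : ∀ s s', P s * P s' = if s = s' then P s else 0)
    (ρ : Matrix D D ℂ) (s : ι) :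
    twirl P ρ * P s = ((P s * ρ).trace / (P s).trace) • P s := by
  simp [twirl, Finset.sum_mul, horth]

theorem mul_eq_ite_of_block {ι D : Type*} [DecidableEq ι] [Fintype D]
    (P : ι → Matrix D D ℂ) (horth : ∀ s s', P s * P s' = if s = s' then P s else 0)
    {s t : ι} {X : Matrix D D ℂ} (hX : P s * X * P t = X) (u : ι) :
    P u * X = if u = s then X else 0 := by
  rw [← hX, ← Matrix.mul_assoc, ← Matrix.mul_assoc, horth]
  split_ifs with h
  · rw [h]
  · simp

theorem block_mul_eq_ite {ι D : Type*} [DecidableEq ι] [Fintype D]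
    (P : ι → Matrix D D ℂ) (horth : ∀ s s', P s * P s' = if s = s' then P s else 0)
    {s t : ι} {X : Matrix D D ℂ} (hX : P s * X * P t = X) (u : ι) :
    X * P u = if u = t then X else 0 := by
  rw [← hX, Matrix.mul_assoc, horth]
  split_ifs with h₁ h₂ h₂
  · rfl
  · exact absurd h₁.symm h₂
  · exact absurd h₂.symm h₁
  · simp

/-- **Spectral action of the Lindblad generator** `L = L_block + L_deph`:
(i) twirled states (in particular each `P_s`) are fixed points of `L`;
(ii) traceless matrices supported in the `s`-th diagonal block are eigenvectors with
eigenvalue `−γ_s`;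
(iii) matrices supported in an off-diagonal block `(s, s')`, `s ≠ s'`, are eigenvectors
with eigenvalue `−(λ_s + λ_{s'})/2`. -/
theorem lindblad_spectral_action
    {ι D : Type*} [Fintype ι] [Nonempty ι] [DecidableEq ι] [Fintype D] [DecidableEq D]
    (P : ι → Matrix D D ℂ)
    (hherm : ∀ s, (P s)ᴴ = P s)
    (horth : ∀ s s', P s * P s' = if s = s' then P s else 0)
    (hsum : ∑ s, P s = 1)
    (hg : ∀ s, 0 < ((P s).trace).re)
    (γ lam : ι → ℝ) (hγ : ∀ s, 0 ≤ γ s) (hlam : ∀ s, 0 ≤ lam s) :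
    ((∀ ρ : Matrix D D ℂ, Lblock P γ (twirl P ρ) + Ldeph P lam (twirl P ρ) = 0) ∧
      ∀ s, Lblock P γ (P s) + Ldeph P lam (P s) = 0) ∧
    (∀ s, ∀ F : Matrix D D ℂ, P s * F * P s = F → F.trace = 0 →
      Lblock P γ F + Ldeph P lam F = -(γ s : ℂ) • F) ∧
    (∀ s s', s ≠ s' → ∀ X : Matrix D D ℂ, P s * X * P s' = X →
      Lblock P γ X + Ldeph P lam X = -(((lam s + lam s') / 2 : ℝ) : ℂ) • X) := by
  have hidem : ∀ s, P s * P s = P s := fun s => by simp [horth]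
  have htr : ∀ s, (P s).trace ≠ 0 := fun s h => by simpa [h] using hg s
  refine ⟨⟨fun ρ => ?_, fun s => ?_⟩, fun s F hF hF0 => ?_, fun s s' hne X hX => ?_⟩
  · exact Lblock_add_Ldeph_eq_zero_of_mul_eq_smul P hidem htr γ lam _ _
      (mul_twirl P horth ρ) (twirl_mul P horth ρ)
  · refine Lblock_add_Ldeph_eq_zero_of_mul_eq_smul P hidem htr γ lam _
      (fun u => if u = s then 1 else 0) (fun u => ?_) (fun u => ?_)
    · simp [horth]
    · rcases eq_or_ne u s with rfl | h
      · simp [hidem]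
      · simp [horth, h, h.symm]
  · have hl := mul_eq_ite_of_block P horth hF
    have hr := block_mul_eq_ite P horth hF
    have hs : ∀ u, P u * F * P u = if u = s then F else 0 := fun u => by
      rw [hl]
      split_ifs with h
      · rw [hr, if_pos h]
      · simp
    have hb : Lblock P γ F = -(γ s : ℂ) • F := by
      rw [Lblock, Finset.sum_eq_single s]
      · simp [hs, hF0]
      · intro u _ hu
        simp [hs, hu]
      · simp
    have hd : Ldeph P lam F = 0 := by
      refine Finset.sum_eq_zero fun u _ => ?_
      rw [hs, hl, hr]
      split_ifs
      · rw [← two_smul ℂ F, smul_smul, inv_mul_cancel₀ two_ne_zero, one_smul, sub_self, smul_zero]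
      · simp
    rw [hb, hd, add_zero]
  · have hl := mul_eq_ite_of_block P horth hX
    have hr := block_mul_eq_ite P horth hX
    have hs : ∀ u, P u * X * P u = 0 := fun u => by
      rw [hl]
      split_ifs with h
      · rw [hr, if_neg (h ▸ hne)]
      · simp
    have hb : Lblock P γ X = 0 := by simp [Lblock, hs]
    rw [hb, zero_add]
    simp only [Ldeph, hs, zero_sub]
    simp only [hl, hr, smul_neg, smul_add, smul_ite, smul_zero, neg_add, Finset.sum_add_distrib,
      Finset.sum_neg_distrib, Finset.sum_ite_eq', Finset.mem_univ, if_true]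
    push_cast
    module

end
end
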